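/- The smallest element of B_{ℵ₀} strictly greater than the golden ratio (1+√5)/2 is q_{ℵ₀} ≈ 1.64541, the unique root in (1,2) of x⁶ = x⁴ + x³ + 2x² + x + 1. That is, q_{ℵ₀} ∈ B_{ℵ₀}, and no q with (1+√5)/2 < q < q_{ℵ₀} belongs to B_{ℵ₀}. -/

import Mathlib

noncomputable section

open Set

/-- The map `T_{q,i}(x) = q*x - i` for a binary digit `i`. -/
def Tmap (q : ℝ) (i : Fin 2) (x : ℝ) : ℝ := q * x - ((i : ℕ) : ℝ)

/-- The value `((ε_i)_{i=1}^∞)_q = ∑_{i=1}^∞ ε_i q^{-i}` of a binary sequence in base `q`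
(the sequence is 0-indexed, so digit `ε i` has weight `q^{-(i+1)}`). -/
def seqVal (q : ℝ) (ε : ℕ → Fin 2) : ℝ := ∑' i : ℕ, ((ε i : ℕ) : ℝ) / q ^ (i + 1)

/-- `Σ_q(x)`: the set of `q`-expansions of `x`. -/
def SigmaSet (q x : ℝ) : Set (ℕ → Fin 2) := {ε | x = seqVal q ε}

/-- The interval `I_q = [0, 1/(q-1)]`. -/
def Iq (q : ℝ) : Set ℝ := Icc 0 (1 / (q - 1))

/-- The switch region `S_q = [1/q, 1/(q(q-1))]`. -/
def Sq (q : ℝ) : Set ℝ := Icc (1 / q) (1 / (q * (q - 1)))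

/-- The interval `J_q = [(q+q²)/(q⁴-1), (1+q³)/(q⁴-1)]`. -/
def Jq (q : ℝ) : Set ℝ := Icc ((q + q ^ 2) / (q ^ 4 - 1)) ((1 + q ^ 3) / (q ^ 4 - 1))

/-- Apply the first `n` maps of a sequence of maps to `x`:
`applySeq a n x = (a_{n-1} ∘ ⋯ ∘ a_0)(x)`. -/
def applySeq (a : ℕ → ℝ → ℝ) (n : ℕ) (x : ℝ) : ℝ := (List.range n).foldl (fun y k => a k y) x

/-- `Ω_q(x)`: the set of sequences of maps, each equal to `T_{q,0}` or `T_{q,1}`,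
all of whose partial compositions applied to `x` stay in `I_q`. -/
def OmegaSet (q x : ℝ) : Set (ℕ → ℝ → ℝ) :=
  {a | (∀ n, a n = Tmap q 0 ∨ a n = Tmap q 1) ∧ ∀ n : ℕ, applySeq a (n + 1) x ∈ Iq q}

/-- Apply a finite word of digits to `x` (first letter applied first):
for `a = [a₁, …, aₙ]`, `wordMap q a x = (T_{q,aₙ} ∘ ⋯ ∘ T_{q,a₁})(x)`. -/
def wordMap (q : ℝ) (a : List (Fin 2)) (x : ℝ) : ℝ := a.foldl (fun y i => Tmap q i y) x

/-- A branching sequence for `x`: a finite word whose partial compositions applied to `x`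
stay in `I_q`, and whose full composition maps `x` into the switch region `S_q`. -/
def IsBranching (q x : ℝ) (a : List (Fin 2)) : Prop :=
  (∀ k, k ≤ a.length → wordMap q (a.take k) x ∈ Iq q) ∧ wordMap q a x ∈ Sq q

/-- `x` is a `q` null infinite point: `x ∈ (0,1/(q-1))`, `Ω_q(x)` is infinite, and for every
branching sequence `a` for `x` there is a digit `i` with `Ω_q(T_{q,i}(a(x)))` finite. -/
def NullInfinite (q x : ℝ) : Prop :=
  x ∈ Ioo 0 (1 / (q - 1)) ∧ (OmegaSet q x).Infinite ∧
    ∀ a : List (Fin 2), IsBranching q x a →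
      ∃ i : Fin 2, (OmegaSet q (Tmap q i (wordMap q a x))).Finite

/-- `U_q`: points of `I_q` with exactly one `q`-expansion. -/
def UniqSet (q : ℝ) : Set ℝ := {x | x ∈ Iq q ∧ ∃! ε : ℕ → Fin 2, ε ∈ SigmaSet q x}

/-- `B_{ℵ₀}`: bases `q ∈ (1,2)` for which some `x ∈ (0,1/(q-1))` has exactly countably
infinitely many `q`-expansions. -/
def BAleph0 : Set ℝ :=
  {q | q ∈ Ioo (1 : ℝ) 2 ∧ ∃ x ∈ Ioo (0 : ℝ) (1 / (q - 1)),
    Cardinal.mk ↥(SigmaSet q x) = Cardinal.aleph0}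

/-- The eventually periodic binary sequence `u w^∞`: the finite word `u` followed by
infinitely many repetitions of the finite word `w`. -/
def uwInf (u w : List (Fin 2)) : ℕ → Fin 2 := fun i =>
  if i < u.length then u.getD i 0 else w.getD ((i - u.length) % w.length) 0

/-- The sequence with first digit `d` followed by `ε`. -/
def consSeq (d : Fin 2) (ε : ℕ → Fin 2) : ℕ → Fin 2
  | 0 => d
  | n + 1 => ε n

lemma consSeq_injective (d : Fin 2) : Function.Injective (consSeq d) := fun _ _ h =>
  funext fun n => congrFun h (n + 1)

lemma consSeq_head_tail (ε : ℕ → Fin 2) : consSeq (ε 0) (fun n => ε (n + 1)) = ε := by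
  funext n; cases n <;> rfl

lemma digit_le_one (i : Fin 2) : ((i : ℕ) : ℝ) ≤ 1 := by
  exact_mod_cast Nat.lt_succ_iff.1 i.2

lemma summable_inv_pow {q : ℝ} (hq : 1 < q) : Summable fun i : ℕ => 1 / q ^ (i + 1) := by
  have h := (summable_geometric_of_lt_one (inv_nonneg.2 (zero_le_one.trans hq.le))
    (inv_lt_one_of_one_lt₀ hq)).mul_left q⁻¹
  refine h.congr fun i => ?_
  rw [pow_succ', one_div, mul_inv, inv_pow]

lemma tsum_inv_pow {q : ℝ} (hq : 1 < q) : ∑' i : ℕ, 1 / q ^ (i + 1) = 1 / (q - 1) := by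
  have h0 : q ≠ 0 := by positivity
  have h1 : q - 1 ≠ 0 := by linarith
  have : ∀ i : ℕ, 1 / q ^ (i + 1) = q⁻¹ * q⁻¹ ^ i := fun i => by
    rw [pow_succ', one_div, mul_inv, inv_pow]
  simp_rw [this]
  rw [tsum_mul_left, tsum_geometric_of_lt_one (inv_nonneg.2 (zero_le_one.trans hq.le))
    (inv_lt_one_of_one_lt₀ hq)]
  field_simp

lemma summable_digits {q : ℝ} (hq : 1 < q) (ε : ℕ → Fin 2) :
    Summable fun i : ℕ => ((ε i : ℕ) : ℝ) / q ^ (i + 1) := by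
  refine Summable.of_nonneg_of_le (fun i => by positivity) (fun i => ?_) (summable_inv_pow hq)
  have := digit_le_one (ε i)
  gcongr

lemma seqVal_consSeq {q : ℝ} (hq : 1 < q) (d : Fin 2) (ε : ℕ → Fin 2) :
    seqVal q ε = Tmap q d (seqVal q (consSeq d ε)) := by
  have h0 : q ≠ 0 := by positivity
  have h := (summable_digits hq (consSeq d ε)).tsum_eq_zero_add
  have h2 : ∀ i : ℕ, ((consSeq d ε (i + 1) : ℕ) : ℝ) / q ^ (i + 1 + 1)
      = q⁻¹ * (((ε i : ℕ) : ℝ) / q ^ (i + 1)) := fun i => by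
    simp only [consSeq]
    field_simp
    ring
  simp_rw [h2] at h
  rw [tsum_mul_left] at h
  unfold Tmap seqVal
  rw [h]
  simp only [consSeq]
  field_simp
  ring

lemma consSeq_mem_SigmaSet {q : ℝ} (hq : 1 < q) {x : ℝ} {d : Fin 2} {ε : ℕ → Fin 2} :
    consSeq d ε ∈ SigmaSet q x ↔ ε ∈ SigmaSet q (Tmap q d x) := by
  have h0 : q ≠ 0 := by positivity
  simp only [SigmaSet, mem_ofPred_eq, seqVal_consSeq hq d ε]
  constructor
  · intro h; rw [h]
  · intro h
    have : q * x = q * seqVal q (consSeq d ε) := by simpa [Tmap] using h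
    exact mul_left_cancel₀ h0 this

lemma tail_mem_SigmaSet {q : ℝ} (hq : 1 < q) {x : ℝ} {ε : ℕ → Fin 2} (h : ε ∈ SigmaSet q x) :
    (fun n => ε (n + 1)) ∈ SigmaSet q (Tmap q (ε 0) x) := by
  rw [← consSeq_mem_SigmaSet hq, consSeq_head_tail]; exact h

lemma SigmaSet_eq_union {q : ℝ} (hq : 1 < q) (x : ℝ) :
    SigmaSet q x = consSeq 0 '' SigmaSet q (Tmap q 0 x) ∪ consSeq 1 '' SigmaSet q (Tmap q 1 x) := by
  ext ε
  constructor
  · intro h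
    have h' := tail_mem_SigmaSet hq h
    have e := consSeq_head_tail ε
    rcases Fin.exists_fin_two.1 ⟨ε 0, rfl⟩ with h0 | h0
    · rw [h0] at h' e
      exact Or.inl ⟨_, h', e⟩
    · rw [h0] at h' e
      exact Or.inr ⟨_, h', e⟩
  · rintro (⟨_, h, rfl⟩ | ⟨_, h, rfl⟩) <;> exact (consSeq_mem_SigmaSet hq).2 h

lemma mem_Iq_of_mem_SigmaSet {q : ℝ} (hq : 1 < q) {x : ℝ} {ε : ℕ → Fin 2}
    (h : ε ∈ SigmaSet q x) : x ∈ Iq q := by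
  rw [show x = seqVal q ε from h]
  refine ⟨tsum_nonneg fun i => by positivity, ?_⟩
  rw [← tsum_inv_pow hq]
  refine (summable_digits hq ε).tsum_le_tsum (fun i => ?_) (summable_inv_pow hq)
  have := digit_le_one (ε i)
  gcongr

/-- Exchange the digits `0` and `1`. -/
def flipSeq (ε : ℕ → Fin 2) : ℕ → Fin 2 := fun n => 1 - ε n

lemma digit_flip_flip (i : Fin 2) : 1 - (1 - i) = i := by
  revert i; decide

lemma cast_flip (i : Fin 2) : (((1 - i : Fin 2) : ℕ) : ℝ) = 1 - ((i : ℕ) : ℝ) := by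
  fin_cases i <;> simp

lemma flipSeq_involutive : Function.Involutive flipSeq := fun ε => funext fun n => digit_flip_flip (ε n)

lemma Tmap_reflect {q : ℝ} (hq : 1 < q) (i : Fin 2) (x : ℝ) :
    Tmap q i (1 / (q - 1) - x) = 1 / (q - 1) - Tmap q (1 - i) x := by
  have h1 : q - 1 ≠ 0 := by linarith
  unfold Tmap
  rw [cast_flip]
  field_simp
  ring

lemma flipSeq_mem {q : ℝ} (hq : 1 < q) {x : ℝ} {ε : ℕ → Fin 2} (h : ε ∈ SigmaSet q x) :
    flipSeq ε ∈ SigmaSet q (1 / (q - 1) - x) := by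
  have h' : x = ∑' i : ℕ, ((ε i : ℕ) : ℝ) / q ^ (i + 1) := h
  change _ = ∑' i : ℕ, ((1 - ε i : Fin 2) : ℕ) / q ^ (i + 1)
  rw [h', ← tsum_inv_pow hq, ← (summable_inv_pow hq).tsum_sub (summable_digits hq ε)]
  simp_rw [cast_flip, sub_div]

lemma SigmaSet_reflect {q : ℝ} (hq : 1 < q) (x : ℝ) :
    SigmaSet q (1 / (q - 1) - x) = flipSeq '' SigmaSet q x := by
  ext ε
  constructor
  · intro h
    exact ⟨flipSeq ε, by simpa using flipSeq_mem hq h, flipSeq_involutive ε⟩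
  · rintro ⟨ε, h, rfl⟩
    exact flipSeq_mem hq h

/-- The orbit of `x` under the digit maps selected by `ε`. -/
def digitOrbit (q x : ℝ) (ε : ℕ → Fin 2) : ℕ → ℝ
  | 0 => x
  | n + 1 => Tmap q (ε n) (digitOrbit q x ε n)

lemma digitOrbit_consSeq (q x : ℝ) (d : Fin 2) (ε : ℕ → Fin 2) (n : ℕ) :
    digitOrbit q x (consSeq d ε) (n + 1) = digitOrbit q (Tmap q d x) ε n := by
  induction n with
  | zero => rfl
  | succ n ih => rw [digitOrbit, ih]; rfl

lemma mem_SigmaSet_of_digitOrbit_mem {q : ℝ} (hq : 1 < q) {x : ℝ} {ε : ℕ → Fin 2}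
    (h : ∀ n, digitOrbit q x ε n ∈ Iq q) : ε ∈ SigmaSet q x := by
  have h0 : q ≠ 0 := by positivity
  have hpart : ∀ n, ∑ i ∈ Finset.range n, ((ε i : ℕ) : ℝ) / q ^ (i + 1)
      = x - digitOrbit q x ε n / q ^ n := by
    intro n
    induction n with
    | zero => simp [digitOrbit]
    | succ n ih =>
      rw [Finset.sum_range_succ, ih, digitOrbit, Tmap]
      field_simp
      ring
  have hlim : Filter.Tendsto (fun n => digitOrbit q x ε n / q ^ n) Filter.atTop (nhds 0) := by
    have hb : Filter.Tendsto (fun n : ℕ => 1 / (q - 1) * q⁻¹ ^ n) Filter.atTop (nhds 0) := by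
      simpa using (tendsto_pow_atTop_nhds_zero_of_lt_one (inv_nonneg.2 (zero_le_one.trans hq.le))
        (inv_lt_one_of_one_lt₀ hq)).const_mul (1 / (q - 1))
    refine squeeze_zero (fun n => div_nonneg (h n).1 (by positivity)) (fun n => ?_) hb
    rw [div_eq_mul_inv, inv_pow]
    have := (h n).2
    gcongr
  have h1 := (summable_digits hq ε).hasSum.tendsto_sum_nat
  simp_rw [hpart] at h1
  have h2 := (tendsto_const_nhds (x := x)).sub hlim
  rw [sub_zero] at h2
  exact tendsto_nhds_unique h2 h1

lemma SigmaSet_nonempty {q : ℝ} (hq : 1 < q) (hq2 : q < 2) {x : ℝ} (hx : x ∈ Iq q) :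
    (SigmaSet q x).Nonempty := by
  have h1 : 0 < q - 1 := by linarith
  have step : ∀ y : Iq q, ∃ d : Fin 2, Tmap q d y ∈ Iq q := by
    rintro ⟨y, hy0, hy1⟩
    rw [le_div_iff₀ h1] at hy1
    by_cases h : q * y < 1
    · refine ⟨0, by simp [Tmap]; positivity, ?_⟩
      rw [le_div_iff₀ h1]
      simp [Tmap]
      nlinarith
    · refine ⟨1, by simp [Tmap]; linarith, ?_⟩
      rw [le_div_iff₀ h1]
      simp [Tmap]
      nlinarith
  choose d hd using step
  let o : ℕ → Iq q := fun n => Nat.rec ⟨x, hx⟩ (fun _ y => ⟨Tmap q (d y) y, hd y⟩) n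
  refine ⟨fun n => d (o n), mem_SigmaSet_of_digitOrbit_mem hq fun n => ?_⟩
  have : digitOrbit q x (fun n => d (o n)) n = (o n).1 := by
    induction n with
    | zero => rfl
    | succ n ih => rw [digitOrbit, ih]
  rw [this]
  exact (o n).2

/-- Sequences along which every point of the orbit of `x` has infinitely many expansions. -/
def infinitePaths (q x : ℝ) : Set (ℕ → Fin 2) :=
  {ε | ∀ n, (SigmaSet q (digitOrbit q x ε n)).Infinite}

lemma infinite_of_infinite_Tmap {q : ℝ} (hq : 1 < q) {x : ℝ} {d : Fin 2}
    (h : (SigmaSet q (Tmap q d x)).Infinite) : (SigmaSet q x).Infinite := by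
  refine (h.image (consSeq_injective d).injOn).mono ?_
  rintro _ ⟨ε, hε, rfl⟩
  exact (consSeq_mem_SigmaSet hq).2 hε

lemma exists_infinite_Tmap {q : ℝ} (hq : 1 < q) {x : ℝ} (h : (SigmaSet q x).Infinite) :
    ∃ d, (SigmaSet q (Tmap q d x)).Infinite := by
  by_contra! hfin
  refine h ?_
  rw [SigmaSet_eq_union hq]
  exact ((hfin 0).image _).union ((hfin 1).image _)

lemma consSeq_mem_infinitePaths {q : ℝ} (hq : 1 < q) {x : ℝ} {d : Fin 2} {ε : ℕ → Fin 2} :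
    consSeq d ε ∈ infinitePaths q x ↔ ε ∈ infinitePaths q (Tmap q d x) := by
  constructor
  · intro h n
    rw [← digitOrbit_consSeq]
    exact h (n + 1)
  · intro h n
    cases n with
    | zero => exact infinite_of_infinite_Tmap hq (h 0)
    | succ n => rw [digitOrbit_consSeq]; exact h n

lemma infinitePaths_nonempty {q : ℝ} (hq : 1 < q) {x : ℝ} (h : (SigmaSet q x).Infinite) :
    (infinitePaths q x).Nonempty := by
  have step : ∀ y : {y // (SigmaSet q y).Infinite}, ∃ d, (SigmaSet q (Tmap q d y)).Infinite :=
    fun y => exists_infinite_Tmap hq y.2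
  choose d hd using step
  let o : ℕ → {y // (SigmaSet q y).Infinite} :=
    fun n => Nat.rec ⟨x, h⟩ (fun _ y => ⟨Tmap q (d y) y, hd y⟩) n
  refine ⟨fun n => d (o n), fun n => ?_⟩
  have : digitOrbit q x (fun n => d (o n)) n = (o n).1 := by
    induction n with
    | zero => rfl
    | succ n ih => rw [digitOrbit, ih]
  rw [this]
  exact (o n).2

lemma infinitePaths_subset {q : ℝ} (hq : 1 < q) (x : ℝ) : infinitePaths q x ⊆ SigmaSet q x := by
  intro ε h
  refine mem_SigmaSet_of_digitOrbit_mem hq fun n => ?_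
  obtain ⟨δ, hδ⟩ := (h n).nonempty
  exact mem_Iq_of_mem_SigmaSet hq hδ

lemma isLocallyConstant_digitOrbit (q x : ℝ) (n : ℕ) :
    IsLocallyConstant fun ε : ℕ → Fin 2 => digitOrbit q x ε n := by
  induction n with
  | zero => exact IsLocallyConstant.const x
  | succ n ih =>
    have h : IsLocallyConstant fun ε : ℕ → Fin 2 => ε n :=
      (IsLocallyConstant.iff_continuous _).2 (continuous_apply n)
    exact h.comp₂ ih (fun d y => Tmap q d y)

lemma isClosed_infinitePaths (q x : ℝ) : IsClosed (infinitePaths q x) := by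
  have : infinitePaths q x = ⋂ n, {ε | (SigmaSet q (digitOrbit q x ε n)).Infinite} := by
    ext ε; simp [infinitePaths]
  rw [this]
  refine isClosed_iInter fun n => ⟨?_⟩
  exact isLocallyConstant_digitOrbit q x n {y | (SigmaSet q y).Infinite}ᶜ

/-- `x` has infinitely many expansions, and no point reachable from `x` has two successors with
infinitely many expansions. -/
def IsThin (q x : ℝ) : Prop :=
  (SigmaSet q x).Infinite ∧ ∀ w : List (Fin 2), ∃ i, (SigmaSet q (Tmap q i (wordMap q w x))).Finite

lemma infinitePaths_nontrivial_of_Tmap {q : ℝ} (hq : 1 < q) {x : ℝ} {d : Fin 2}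
    (h : (infinitePaths q (Tmap q d x)).Nontrivial) : (infinitePaths q x).Nontrivial := by
  obtain ⟨ε, hε, δ, hδ, hne⟩ := h
  exact ⟨_, (consSeq_mem_infinitePaths hq).2 hε, _, (consSeq_mem_infinitePaths hq).2 hδ,
    fun h => hne (consSeq_injective d h)⟩

lemma infinitePaths_nontrivial_of_wordMap {q : ℝ} (hq : 1 < q) (w : List (Fin 2)) {x : ℝ}
    (h : (infinitePaths q (wordMap q w x)).Nontrivial) : (infinitePaths q x).Nontrivial := by
  induction w generalizing x with
  | nil => exact h
  | cons d w ih => exact infinitePaths_nontrivial_of_Tmap hq (ih h)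

lemma infinitePaths_nontrivial {q : ℝ} (hq : 1 < q) {x : ℝ} (h : (SigmaSet q x).Infinite)
    (hx : ¬ IsThin q x) : (infinitePaths q x).Nontrivial := by
  have : ∃ w : List (Fin 2), ∀ i, (SigmaSet q (Tmap q i (wordMap q w x))).Infinite := by
    by_contra! hw
    exact hx ⟨h, hw⟩
  obtain ⟨w, hw⟩ := this
  refine infinitePaths_nontrivial_of_wordMap hq w ?_
  obtain ⟨ε, hε⟩ := infinitePaths_nonempty hq (hw 0)
  obtain ⟨δ, hδ⟩ := infinitePaths_nonempty hq (hw 1)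
  exact ⟨_, (consSeq_mem_infinitePaths hq).2 hε, _, (consSeq_mem_infinitePaths hq).2 hδ,
    fun h => by simpa [consSeq] using congrFun h 0⟩

lemma exists_ne_mem_infinitePaths {q : ℝ} (hq : 1 < q) (n : ℕ) {x : ℝ} {ε : ℕ → Fin 2}
    (h : ε ∈ infinitePaths q x) (hn : (infinitePaths q (digitOrbit q x ε n)).Nontrivial) :
    ∃ δ ∈ infinitePaths q x, δ ≠ ε ∧ ∀ i < n, δ i = ε i := by
  induction n generalizing x ε with
  | zero =>
    obtain ⟨δ, hδ, hne⟩ := hn.exists_ne ε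
    exact ⟨δ, hδ, hne, by simp⟩
  | succ n ih =>
    have e := consSeq_head_tail ε
    rw [← e] at h hn
    rw [digitOrbit_consSeq] at hn
    obtain ⟨δ, hδ, hne, hi⟩ := ih ((consSeq_mem_infinitePaths hq).1 h) hn
    refine ⟨consSeq (ε 0) δ, (consSeq_mem_infinitePaths hq).2 hδ, fun h' => hne ?_, fun i hin => ?_⟩
    · rw [← e] at h'
      exact consSeq_injective _ h'
    · cases i with
      | zero => rfl
      | succ i => exact hi i (by omega)

lemma exists_isThin {q : ℝ} (hq : 1 < q) {x : ℝ} (hinf : (SigmaSet q x).Infinite)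
    (hc : (SigmaSet q x).Countable) : ∃ y, IsThin q y := by
  by_contra! hthin
  let := PiNat.metricSpace (E := fun _ => Fin 2)
  have := PiNat.completeSpace (E := fun _ => Fin 2)
  have hperf : Perfect (infinitePaths q x) := by
    refine ⟨isClosed_infinitePaths q x, preperfect_iff_nhds.2 fun ε hε U hU => ?_⟩
    obtain ⟨_, ⟨δ, n, rfl⟩, hεn, hnU⟩ :=
      (PiNat.isTopologicalBasis_cylinders fun _ => Fin 2).mem_nhds_iff.1 hU
    obtain ⟨η, hη, hne, hi⟩ := exists_ne_mem_infinitePaths hq n hε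
      (infinitePaths_nontrivial hq (hε n) (hthin _))
    refine ⟨η, ⟨hnU fun i hin => ?_, hη⟩, hne⟩
    rw [hi i hin, hεn i hin]
  obtain ⟨f, hf, -, hinj⟩ := hperf.exists_nat_bool_injection (infinitePaths_nonempty hq hinf)
  have h1 : (range f).Countable := hc.mono (hf.trans (infinitePaths_subset hq x))
  have h2 : Countable (ℕ → Bool) := by
    rw [← image_univ] at h1
    exact countable_univ_iff.1 (countable_of_injective_of_countable_image hinj.injOn h1)
  have h3 := Cardinal.mk_le_aleph0_iff.2 h2
  simp only [Cardinal.mk_pi, Cardinal.mk_fintype, Fintype.card_bool, Cardinal.prod_const] at h3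
  simp at h3
  exact absurd h3 (not_le.2 (Cardinal.cantor _))

lemma digit_eq_or_eq_flip (d e : Fin 2) : e = d ∨ e = 1 - d := by
  revert d e; decide

lemma Tmap_zero (q x : ℝ) : Tmap q 0 x = q * x := by simp [Tmap]

lemma Tmap_one (q x : ℝ) : Tmap q 1 x = q * x - 1 := by simp [Tmap]

lemma IsThin.mem_Iq {q : ℝ} (hq : 1 < q) {x : ℝ} (h : IsThin q x) : x ∈ Iq q := by
  obtain ⟨ε, hε⟩ := h.1.nonempty
  exact mem_Iq_of_mem_SigmaSet hq hε

lemma IsThin.step {q : ℝ} {x : ℝ} {d : Fin 2} (h : IsThin q x)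
    (hd : (SigmaSet q (Tmap q d x)).Infinite) : IsThin q (Tmap q d x) :=
  ⟨hd, fun w => h.2 (d :: w)⟩

lemma IsThin.step_of_finite {q : ℝ} (hq : 1 < q) {x : ℝ} {d : Fin 2} (h : IsThin q x)
    (hd : (SigmaSet q (Tmap q d x)).Finite) : IsThin q (Tmap q (1 - d) x) := by
  refine h.step fun hfin => ?_
  obtain ⟨e, he⟩ := exists_infinite_Tmap hq h.1
  rcases digit_eq_or_eq_flip d e with rfl | rfl
  · exact he hd
  · exact he hfin

lemma SigmaSet_eq_empty {q : ℝ} (hq : 1 < q) {x : ℝ} (hx : x ∉ Iq q) : SigmaSet q x = ∅ := by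
  by_contra h
  obtain ⟨ε, hε⟩ := nonempty_iff_ne_empty.2 h
  exact hx (mem_Iq_of_mem_SigmaSet hq hε)

lemma IsThin.step_one {q : ℝ} (hq : 1 < q) {x : ℝ} (h : IsThin q x) (hx : 1 / (q - 1) < q * x) :
    IsThin q (q * x - 1) := by
  rw [← Tmap_one]
  refine h.step_of_finite (d := 0) hq ?_
  rw [SigmaSet_eq_empty hq]
  · exact finite_empty
  · rw [Tmap_zero]
    exact fun h' => not_lt.2 h'.2 hx

lemma wordMap_reflect {q : ℝ} (hq : 1 < q) (w : List (Fin 2)) (x : ℝ) :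
    wordMap q w (1 / (q - 1) - x) = 1 / (q - 1) - wordMap q (w.map (1 - ·)) x := by
  induction w generalizing x with
  | nil => rfl
  | cons d w ih =>
    change wordMap q w (Tmap q d _) = 1 / (q - 1) - wordMap q (w.map (1 - ·)) (Tmap q (1 - d) x)
    rw [Tmap_reflect hq, ih]

lemma IsThin.reflect {q : ℝ} (hq : 1 < q) {x : ℝ} (h : IsThin q x) :
    IsThin q (1 / (q - 1) - x) := by
  constructor
  · rw [SigmaSet_reflect hq]
    exact h.1.image flipSeq_involutive.injective.injOn
  · intro w
    obtain ⟨i, hi⟩ := h.2 (w.map (1 - ·))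
    refine ⟨1 - i, ?_⟩
    rw [wordMap_reflect hq, Tmap_reflect hq, digit_flip_flip, SigmaSet_reflect hq]
    exact hi.image _

/-- `x` has exactly one expansion in base `q`. -/
def HasUniqueExpansion (q x : ℝ) : Prop := x ∈ Iq q ∧ (SigmaSet q x).Subsingleton

lemma HasUniqueExpansion.step {q : ℝ} (hq : 1 < q) {x : ℝ} {d : Fin 2}
    (h : HasUniqueExpansion q x) (hd : Tmap q d x ∈ Iq q) : HasUniqueExpansion q (Tmap q d x) :=
  ⟨hd, fun _ hε _ hδ => consSeq_injective d
    (h.2 ((consSeq_mem_SigmaSet hq).2 hε) ((consSeq_mem_SigmaSet hq).2 hδ))⟩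

lemma HasUniqueExpansion.not_switch {q : ℝ} (hq : 1 < q) (hq2 : q < 2) {x : ℝ}
    (h : HasUniqueExpansion q x) (h0 : 1 ≤ q * x) : 1 / (q - 1) < q * x := by
  have hpos : 0 < 1 / (q - 1) := one_div_pos.2 (by linarith)
  by_contra! h1
  obtain ⟨ε, hε⟩ := SigmaSet_nonempty hq hq2 (x := Tmap q 0 x)
    (by rw [Tmap_zero]; exact ⟨by linarith, h1⟩)
  obtain ⟨δ, hδ⟩ := SigmaSet_nonempty hq hq2 (x := Tmap q 1 x)
    (by rw [Tmap_one]; exact ⟨by linarith, by linarith⟩)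
  have := h.2 ((consSeq_mem_SigmaSet hq).2 hε) ((consSeq_mem_SigmaSet hq).2 hδ)
  simpa [consSeq] using congrFun this 0

lemma reflect_mem_Iq {q x : ℝ} (hx : x ∈ Iq q) : 1 / (q - 1) - x ∈ Iq q :=
  ⟨sub_nonneg.2 hx.2, by linarith [hx.1]⟩

lemma HasUniqueExpansion.reflect {q : ℝ} (hq : 1 < q) {x : ℝ} (h : HasUniqueExpansion q x) :
    HasUniqueExpansion q (1 / (q - 1) - x) :=
  ⟨reflect_mem_Iq h.1, by rw [SigmaSet_reflect hq]; exact h.2.image _⟩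

lemma nonempty_of_nonempty_wordMap {q : ℝ} (hq : 1 < q) (w : List (Fin 2)) {x : ℝ}
    (h : (SigmaSet q (wordMap q w x)).Nonempty) : (SigmaSet q x).Nonempty := by
  induction w generalizing x with
  | nil => exact h
  | cons d w ih =>
    obtain ⟨ε, hε⟩ := ih h
    exact ⟨_, (consSeq_mem_SigmaSet hq).2 hε⟩

lemma exists_switch_word {q : ℝ} (hq : 1 < q) (m : ℕ) {x : ℝ} {ε δ : ℕ → Fin 2}
    (hε : ε ∈ SigmaSet q x) (hδ : δ ∈ SigmaSet q x) (hm : ε m ≠ δ m) :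
    ∃ w, ∀ i, (SigmaSet q (Tmap q i (wordMap q w x))).Nonempty := by
  induction m generalizing x ε δ with
  | zero =>
    refine ⟨[], fun i => ?_⟩
    have : i = ε 0 ∨ i = δ 0 := by
      generalize ε 0 = e at hm ⊢
      generalize δ 0 = f at hm ⊢
      revert i e f; decide
    rcases this with rfl | rfl
    · exact ⟨_, tail_mem_SigmaSet hq hε⟩
    · exact ⟨_, tail_mem_SigmaSet hq hδ⟩
  | succ m ih =>
    by_cases h0 : ε 0 = δ 0
    · have h1 := tail_mem_SigmaSet hq hδ
      rw [← h0] at h1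
      obtain ⟨w, hw⟩ := ih (tail_mem_SigmaSet hq hε) h1 hm
      exact ⟨ε 0 :: w, hw⟩
    · refine ⟨[], fun i => ?_⟩
      have : i = ε 0 ∨ i = δ 0 := by
        generalize ε 0 = e at h0 ⊢
        generalize δ 0 = f at h0 ⊢
        revert i e f; decide
      rcases this with rfl | rfl
      · exact ⟨_, tail_mem_SigmaSet hq hε⟩
      · exact ⟨_, tail_mem_SigmaSet hq hδ⟩

lemma IsThin.exists_switch {q : ℝ} (hq : 1 < q) {x : ℝ} (h : IsThin q x) :
    ∃ y, IsThin q y ∧ Tmap q 0 y ∈ Iq q ∧ Tmap q 1 y ∈ Iq q := by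
  obtain ⟨ε, hε, δ, hδ, hne⟩ := h.1.nontrivial
  obtain ⟨m, hm⟩ := Function.ne_iff.1 hne
  obtain ⟨w, hw⟩ := exists_switch_word hq m hε hδ hm
  clear hε hδ
  induction w generalizing x with
  | nil =>
    obtain ⟨α, hα⟩ := hw 0
    obtain ⟨β, hβ⟩ := hw 1
    exact ⟨x, h, mem_Iq_of_mem_SigmaSet hq hα, mem_Iq_of_mem_SigmaSet hq hβ⟩
  | cons d w ih =>
    by_cases hd : (SigmaSet q (Tmap q d x)).Infinite
    · exact ih (h.step hd) hw
    · have hd' := not_infinite.1 hd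
      have h1 := h.step_of_finite hq hd'
      have h2 : Tmap q d x ∈ Iq q := by
        obtain ⟨ε, hε⟩ := hw 0
        obtain ⟨δ, hδ⟩ := nonempty_of_nonempty_wordMap hq w ⟨_, (consSeq_mem_SigmaSet hq).2 hε⟩
        exact mem_Iq_of_mem_SigmaSet hq hδ
      have h3 := h1.mem_Iq hq
      refine ⟨x, h, ?_⟩
      rcases digit_eq_or_eq_flip 0 d with rfl | rfl
      · exact ⟨h2, h3⟩
      · exact ⟨h3, h2⟩

/-- If no point has exactly two expansions, finite sets of expansions are subsingletons. -/
lemma subsingleton_of_finite {q : ℝ} (hq : 1 < q)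
    (H : ∀ z, HasUniqueExpansion q (Tmap q 0 z) → ¬ HasUniqueExpansion q (Tmap q 1 z)) {x : ℝ}
    (hfin : (SigmaSet q x).Finite) : (SigmaSet q x).Subsingleton := by
  have key : ∀ n, ∀ z, (SigmaSet q z).Finite → (SigmaSet q z).ncard = n →
      (SigmaSet q z).Subsingleton := by
    intro n
    induction n using Nat.strong_induction_on with
    | _ n ih =>
      intro z hz hn
      by_contra hns
      obtain ⟨ε, hε, δ, hδ, hne⟩ := not_subsingleton_iff.1 hns
      obtain ⟨m, hm⟩ := Function.ne_iff.1 hne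
      obtain ⟨w, hw⟩ := exists_switch_word hq m hε hδ hm
      have hle : ∀ (w : List (Fin 2)) (z : ℝ), (SigmaSet q z).Finite →
          (SigmaSet q (wordMap q w z)).Finite ∧
            (SigmaSet q (wordMap q w z)).ncard ≤ (SigmaSet q z).ncard := by
        intro w
        induction w with
        | nil => exact fun z hz => ⟨hz, le_rfl⟩
        | cons d w ihw =>
          intro z hz
          have hsub : consSeq d '' SigmaSet q (Tmap q d z) ⊆ SigmaSet q z := by
            rintro _ ⟨ε, hε, rfl⟩
            exact (consSeq_mem_SigmaSet hq).2 hε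
          have hf := (hz.subset hsub).of_finite_image (consSeq_injective d).injOn
          refine ⟨(ihw _ hf).1, (ihw _ hf).2.trans ?_⟩
          rw [← ncard_image_of_injective _ (consSeq_injective d)]
          exact ncard_le_ncard hsub hz
      obtain ⟨hyf, hyc⟩ := hle w z hz
      have hsum := SigmaSet_eq_union hq (wordMap q w z)
      have hf : ∀ i, (SigmaSet q (Tmap q i (wordMap q w z))).Finite := fun i => (hle [i] _ hyf).1
      have hdisj : Disjoint (consSeq 0 '' SigmaSet q (Tmap q 0 (wordMap q w z)))
          (consSeq 1 '' SigmaSet q (Tmap q 1 (wordMap q w z))) := by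
        rw [Set.disjoint_left]
        rintro _ ⟨α, -, rfl⟩ ⟨β, -, h⟩
        simpa [consSeq] using congrFun h 0
      have hcard := congrArg ncard hsum
      rw [ncard_union_eq hdisj ((hf 0).image _) ((hf 1).image _),
        ncard_image_of_injective _ (consSeq_injective 0),
        ncard_image_of_injective _ (consSeq_injective 1)] at hcard
      have p0 := (ncard_pos (hf 0)).2 (hw 0)
      have p1 := (ncard_pos (hf 1)).2 (hw 1)
      have hu : ∀ i, (SigmaSet q (Tmap q i (wordMap q w z))).ncard < n →
          HasUniqueExpansion q (Tmap q i (wordMap q w z)) := fun i hi => by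
        obtain ⟨α, hα⟩ := hw i
        exact ⟨mem_Iq_of_mem_SigmaSet hq hα, ih _ hi _ (hf i) rfl⟩
      exact H _ (hu 0 (by omega)) (hu 1 (by omega))
  exact key _ x hfin rfl

lemma IsThin.switch {q : ℝ} (hq : 1 < q)
    (H : ∀ z, HasUniqueExpansion q (Tmap q 0 z) → ¬ HasUniqueExpansion q (Tmap q 1 z)) {x : ℝ}
    (h : IsThin q x) (h0 : 1 ≤ q * x) (h1 : q * x ≤ 1 / (q - 1)) :
    (HasUniqueExpansion q (q * x - 1) ∧ IsThin q (q * x)) ∨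
      (HasUniqueExpansion q (1 / (q - 1) - q * x) ∧ IsThin q (1 / (q - 1) - (q * x - 1))) := by
  obtain ⟨i, hi⟩ := h.2 []
  have ht := h.step_of_finite hq hi
  have hs := subsingleton_of_finite hq H hi
  rcases digit_eq_or_eq_flip 0 i with rfl | rfl
  · right
    change (SigmaSet q (Tmap q 0 x)).Subsingleton at hs
    change IsThin q (Tmap q 1 x) at ht
    rw [Tmap_zero] at hs
    rw [Tmap_one] at ht
    exact ⟨HasUniqueExpansion.reflect hq ⟨⟨by linarith, h1⟩, hs⟩, ht.reflect hq⟩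
  · left
    change (SigmaSet q (Tmap q 1 x)).Subsingleton at hs
    change IsThin q (Tmap q 0 x) at ht
    rw [Tmap_one] at hs
    rw [Tmap_zero] at ht
    exact ⟨⟨⟨by linarith, by linarith⟩, hs⟩, ht⟩

/-- The values `0` and `0^k(10)^∞`, `k ≥ 2`. -/
def smallUnique (q : ℝ) : Set ℝ := {a | a = 0 ∨ ∃ k : ℕ, a = 1 / ((q ^ 2 - 1) * q ^ (k + 1))}

lemma smallUnique_cases {q b : ℝ} (hq : 1 < q) (hb : b * q ^ 5 * (q ^ 2 - 1) = 1) {a : ℝ}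
    (ha : a ∈ smallUnique q) :
    a = b * q ^ 4 ∨ a = b * q ^ 3 ∨ a = b * q ^ 2 ∨ a = b * q ∨ 0 ≤ a ∧ a ≤ b := by
  have h0 : 0 < q := by linarith
  have h1 : 0 < q ^ 2 - 1 := by nlinarith
  have hb' : b = 1 / ((q ^ 2 - 1) * q ^ 5) := by
    rw [eq_div_iff (by positivity)]; linarith
  rcases ha with rfl | ⟨k, rfl⟩
  · refine Or.inr (Or.inr (Or.inr (Or.inr ⟨le_rfl, ?_⟩)))
    rw [hb']; positivity
  · rw [hb']
    match k with
    | 0 => left; rw [zero_add, pow_one]; field_simp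
    | 1 => right; left; field_simp
    | 2 => right; right; left; field_simp
    | 3 => right; right; right; left; field_simp
    | k + 4 =>
      refine Or.inr (Or.inr (Or.inr (Or.inr ⟨by positivity, ?_⟩)))
      have : q ^ 5 ≤ q ^ (k + 4 + 1) := pow_le_pow_right₀ hq.le (by omega)
      gcongr

lemma smallUnique_gap {q a a' : ℝ} (hq : 1 < q) (ha : a ∈ smallUnique q) (ha' : a' ∈ smallUnique q)
    (hpos : 0 < a) (h : q ^ 2 * a < a') : q ^ 3 * a ≤ a' := by
  have h0 : 0 < q := by linarith
  have h1 : 0 < q ^ 2 - 1 := by nlinarith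
  have hpos' : 0 < a' := lt_trans (by positivity) h
  obtain rfl | ⟨k, rfl⟩ := ha
  · exact absurd hpos (lt_irrefl _)
  obtain rfl | ⟨j, rfl⟩ := ha'
  · exact absurd hpos' (lt_irrefl _)
  have hlt : q ^ (j + 3) < q ^ (k + 1) := by
    rw [mul_one_div, div_lt_div_iff₀ (by positivity) (by positivity), one_mul] at h
    refine lt_of_mul_lt_mul_left (a := q ^ 2 - 1) ?_ h1.le
    calc (q ^ 2 - 1) * q ^ (j + 3) = q ^ 2 * ((q ^ 2 - 1) * q ^ (j + 1)) := by ring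
      _ < _ := h
  have hjk : j + 4 ≤ k + 1 := (pow_lt_pow_iff_right₀ hq).1 hlt
  have hle : q ^ (j + 4) ≤ q ^ (k + 1) := pow_le_pow_right₀ hq.le hjk
  rw [mul_one_div, div_le_div_iff₀ (by positivity) (by positivity), one_mul]
  calc q ^ 3 * ((q ^ 2 - 1) * q ^ (j + 1)) = (q ^ 2 - 1) * q ^ (j + 4) := by ring
    _ ≤ _ := by gcongr

lemma eq_of_hasUniqueExpansion_of_mem_Icc {q : ℝ} (hq : 1 < q) (hq2 : q < 2) (hG : q + 1 < q ^ 2)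
    (hf : q * (q - 1) ^ 2 < 1) {x : ℝ} (h : HasUniqueExpansion q x) (h0 : 1 ≤ q * x) (h1 : x ≤ 1) :
    x = q / (q ^ 2 - 1) := by
  have hqp : 0 < q := by linarith
  have hq1 : 0 < q - 1 := by linarith
  have hs : 0 < q ^ 2 - 1 := by nlinarith
  set p := q / (q ^ 2 - 1) with hp
  have hp' : q ^ 2 * p - q = p := by rw [hp]; field_simp; ring
  have hM1 : 1 < 1 / (q - 1) := by rw [lt_div_iff₀ hq1]; linarith
  have key : ∀ n : ℕ, HasUniqueExpansion q (p + q ^ (2 * n) * (x - p)) ∧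
      1 ≤ q * (p + q ^ (2 * n) * (x - p)) ∧ p + q ^ (2 * n) * (x - p) ≤ 1 := by
    intro n
    induction n with
    | zero => simpa using ⟨h, h0, h1⟩
    | succ n ih =>
      have e : p + q ^ (2 * (n + 1)) * (x - p) = q * (q * (p + q ^ (2 * n) * (x - p)) - 1) := by
        linear_combination (-1 : ℝ) * hp'
      rw [e]
      generalize p + q ^ (2 * n) * (x - p) = y at ih
      obtain ⟨hu, hy0, hy1⟩ := ih
      have hy := hu.not_switch hq hq2 hy0
      have hqm : q - 1 < 1 / (q - 1) := by rw [lt_div_iff₀ hq1]; nlinarith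
      have hu1 : HasUniqueExpansion q (q * y - 1) := by
        rw [← Tmap_one]
        refine hu.step hq ?_
        rw [Tmap_one]
        exact ⟨by linarith, by nlinarith⟩
      have hy2 : q * (q * y - 1) < 1 := by
        by_contra! hc
        have := hu1.not_switch hq hq2 hc
        rw [div_lt_iff₀ hq1] at this
        have h3 : q * (q * y - 1) * (q - 1) ≤ q * (q - 1) * (q - 1) := by
          have : q * y - 1 ≤ q - 1 := by nlinarith
          gcongr
        nlinarith
      refine ⟨?_, ?_, hy2.le⟩
      · rw [← Tmap_zero]
        refine hu1.step hq ?_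
        rw [Tmap_zero]
        exact ⟨mul_nonneg hqp.le (by linarith), by linarith⟩
      · rw [div_lt_iff₀ hq1] at hy
        have h4 : (2 - q) ≤ (q * y - 1) * (q - 1) := by nlinarith
        have h5 : q - 1 ≤ q ^ 2 * (2 - q) := by nlinarith
        have h6 : 1 * (q - 1) ≤ q * (q * (q * y - 1)) * (q - 1) := by nlinarith
        exact le_of_mul_le_mul_right h6 hq1
  by_contra hne
  have hd : 0 < |x - p| := abs_pos.2 (sub_ne_zero.2 hne)
  obtain ⟨n, hn⟩ := pow_unbounded_of_one_lt (1 / |x - p|) (show 1 < q ^ 2 by nlinarith)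
  rw [div_lt_iff₀ hd, ← pow_mul] at hn
  obtain ⟨-, k0, k1⟩ := key n
  have hy0 : 0 < p + q ^ (2 * n) * (x - p) := by
    by_contra! hc
    nlinarith
  have hp0 : 0 < p := by positivity
  have hp1 : p ≤ 1 := by rw [hp, div_le_one hs]; linarith
  have : |q ^ (2 * n) * (x - p)| ≤ 1 := abs_le.2 ⟨by linarith, by linarith⟩
  rw [abs_mul, abs_of_pos (by positivity : 0 < q ^ (2 * n))] at this
  linarith

lemma mem_smallUnique {q : ℝ} (hq : 1 < q) (hq2 : q < 2) (hG : q + 1 < q ^ 2)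
    (hf : q * (q - 1) ^ 2 < 1) {x : ℝ} (h : HasUniqueExpansion q x)
    (hx : x + 1 ≤ 1 / (q - 1)) : x ∈ smallUnique q := by
  have hqp : 0 < q := by linarith
  have hq1 : 0 < q - 1 := by linarith
  have hs : 0 < q ^ 2 - 1 := by nlinarith
  have hM1 : 1 < 1 / (q - 1) := by rw [lt_div_iff₀ hq1]; linarith
  rcases h.1.1.eq_or_lt with h0 | h0
  · exact Or.inl h0.symm
  have hx1 : x * (q ^ 2 - 1) < 1 := by
    rw [le_div_iff₀ hq1] at hx
    nlinarith
  have hx1' : x ≤ 1 := by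
    by_contra! hc
    nlinarith
  obtain ⟨n, hn1, hn2⟩ := exists_nat_pow_near (one_le_one_div h0 hx1') hq
  rw [le_div_iff₀ h0] at hn1
  rw [div_lt_iff₀ h0] at hn2
  have hu : ∀ m ≤ n, HasUniqueExpansion q (q ^ m * x) := by
    intro m
    induction m with
    | zero => intro _; simpa using h
    | succ m ih =>
      intro hm
      have e : q ^ (m + 1) * x = Tmap q 0 (q ^ m * x) := by rw [Tmap_zero]; ring
      rw [e]
      refine (ih (by omega)).step hq ?_
      rw [← e]
      refine ⟨by positivity, ?_⟩
      have : q ^ (m + 1) * x ≤ q ^ n * x := by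
        have := pow_le_pow_right₀ hq.le hm
        gcongr
      linarith
  have he := eq_of_hasUniqueExpansion_of_mem_Icc hq hq2 hG hf (hu n le_rfl)
    (by rw [← mul_assoc, ← pow_succ']; exact hn2.le) hn1
  rw [eq_div_iff hs.ne'] at he
  match n with
  | 0 => nlinarith
  | 1 => nlinarith
  | k + 2 =>
    refine Or.inr ⟨k, ?_⟩
    rw [eq_div_iff (by positivity)]
    refine mul_left_cancel₀ hqp.ne' ?_
    linear_combination he

/-- The bases strictly between the golden ratio and `q_{ℵ₀}`. -/
structure IsIntermediate (q : ℝ) : Prop where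
  golden_lt : 0 < q ^ 2 - q - 1
  lt_root : (q ^ 2 - q - 1) * (q ^ 4 + q ^ 3 + q ^ 2 + q) < 1
  lower : 1.6 < q
  upper : q < 1.65

/-- The reflection centre in terms of `b = q⁻⁵ / (q² - 1)`. -/
lemma one_div_sub_one_eq {q b : ℝ} (hq : 1 < q) (hb : b * q ^ 5 * (q ^ 2 - 1) = 1) :
    1 / (q - 1) = 1 + b * q ^ 5 * (1 - (q ^ 2 - q - 1)) := by
  rw [div_eq_iff (by linarith)]
  linear_combination (q - 2) * hb

lemma pos_of_mul_pow_eq {q b : ℝ} (hq : 1 < q) (hb : b * q ^ 5 * (q ^ 2 - 1) = 1) : 0 < b := by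
  have hpos : 0 < q ^ 2 - 1 := by nlinarith
  by_contra! hc
  have : b * q ^ 5 * (q ^ 2 - 1) ≤ 0 :=
    mul_nonpos_of_nonpos_of_nonneg (mul_nonpos_of_nonpos_of_nonneg hc (by positivity)) hpos.le
  linarith

lemma mul_pow_chain {q b : ℝ} (hq : 1 < q) (hb : 0 < b) :
    b < b * q ∧ b * q < b * q ^ 2 ∧ b * q ^ 2 < b * q ^ 3 ∧ b * q ^ 3 < b * q ^ 4 ∧
      b * q ^ 4 < b * q ^ 5 ∧ b * q ^ 5 < b * q ^ 6 := by
  have h : ∀ n : ℕ, b * q ^ n < b * q ^ (n + 1) := fun n =>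
    mul_lt_mul_of_pos_left (pow_lt_pow_right₀ hq n.lt_succ_self) hb
  exact ⟨by simpa using h 0, by simpa using h 1, h 2, h 3, h 4, h 5⟩

lemma not_hasUniqueExpansion_both {q : ℝ} (hq : IsIntermediate q) (z : ℝ)
    (h0 : HasUniqueExpansion q (Tmap q 0 z)) : ¬ HasUniqueExpansion q (Tmap q 1 z) := by
  intro h1
  obtain ⟨hs, hh, hl, hu⟩ := hq
  have hq1 : 1 < q := by linarith
  have hq2 : q < 2 := by linarith
  have hf : q * (q - 1) ^ 2 < 1 := by nlinarith
  have hG : q + 1 < q ^ 2 := by linarith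
  rw [Tmap_zero] at h0
  rw [Tmap_one] at h1
  have m1 := mem_smallUnique hq1 hq2 hG hf h1 (by linarith [h0.1.2])
  have m0 := mem_smallUnique hq1 hq2 hG hf (h0.reflect hq1) (by linarith [h1.1.1])
  have hpos : 0 < q ^ 2 - 1 := by nlinarith
  obtain ⟨b, hb⟩ : ∃ b, b * q ^ 5 * (q ^ 2 - 1) = 1 := ⟨1 / (q ^ 5 * (q ^ 2 - 1)), by field_simp⟩
  have hb0 := pos_of_mul_pow_eq hq1 hb
  have hM := one_div_sub_one_eq hq1 hb
  have c1 := smallUnique_cases hq1 hb m1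
  have c0 := smallUnique_cases hq1 hb m0
  generalize ha : q * z - 1 = a at c1
  generalize ha' : 1 / (q - 1) - q * z = a' at c0
  have hsum : a + a' = b * q ^ 5 * (1 - (q ^ 2 - q - 1)) := by linarith
  have k1 : q ^ 3 * (1 - (q ^ 2 - q - 1)) < q ^ 2 + q := by
    have : 0 < q * (q + 1) * (q - 1) * (q ^ 2 - q - 1) :=
      mul_pos (mul_pos (by positivity) (by linarith)) hs
    linarith
  have k2 : q ^ 2 + 1 < q ^ 3 * (1 - (q ^ 2 - q - 1)) := by
    have : q ^ 5 * (q ^ 2 - q - 1) < 1.2 := by nlinarith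
    nlinarith
  have k1' := mul_lt_mul_of_pos_left k1 (show 0 < b * q ^ 2 by positivity)
  have k2' := mul_lt_mul_of_pos_left k2 (show 0 < b * q ^ 2 by positivity)
  obtain ⟨e1, e2, e3, e4, -, -⟩ := mul_pow_chain hq1 hb0
  have e5 : 2 * (b * q ^ 3) ≤ b * q ^ 4 + b * q ^ 2 := by
    have := mul_nonneg (show 0 ≤ b * q ^ 2 by positivity) (sq_nonneg (q - 1))
    linarith
  rcases c1 with h | h | h | h | h <;> rcases c0 with h' | h' | h' | h' | h' <;>
    linarith

lemma IsThin.next_of_switch {q : ℝ} (hq : IsIntermediate q) {y : ℝ} (hy : IsThin q y)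
    (h0 : 1 ≤ q * y) (h1 : q * y ≤ 1 / (q - 1)) :
    (q * y - 1 ∈ smallUnique q ∧ IsThin q (1 + (q * y - 1))) ∨
      (1 / (q - 1) - q * y ∈ smallUnique q ∧ IsThin q (1 + (1 / (q - 1) - q * y))) := by
  have H := not_hasUniqueExpansion_both hq
  obtain ⟨hs, hh, hl, hu⟩ := hq
  have hq1 : 1 < q := by linarith
  have hq2 : q < 2 := by linarith
  have hf : q * (q - 1) ^ 2 < 1 := by nlinarith
  have hG : q + 1 < q ^ 2 := by linarith
  rcases hy.switch hq1 H h0 h1 with ⟨hU, hT⟩ | ⟨hU, hT⟩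
  · exact Or.inl ⟨mem_smallUnique hq1 hq2 hG hf hU (by linarith), by rwa [add_sub_cancel]⟩
  · refine Or.inr ⟨mem_smallUnique hq1 hq2 hG hf hU (by linarith), ?_⟩
    convert hT using 1
    ring

lemma smallUnique_nonneg {q a : ℝ} (hq : 1 < q) (ha : a ∈ smallUnique q) : 0 ≤ a := by
  have : 0 < q ^ 2 - 1 := by nlinarith
  rcases ha with rfl | ⟨k, rfl⟩
  · exact le_rfl
  · positivity

/-- `1 + a` with a small `a` is followed by `1 + a'` with `a' = q² a + (q² - q - 1)`. -/
lemma IsThin.next_of_le {q b a : ℝ} (hq : IsIntermediate q) (hb : b * q ^ 5 * (q ^ 2 - 1) = 1)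
    (ha : a ∈ smallUnique q) (hab : a ≤ b * q ^ 2) (ht : IsThin q (q * (1 + a) - 1)) :
    ∃ a' ∈ smallUnique q, IsThin q (1 + a') ∧ a' ≤ b * q ^ 2 ∧
      a' = q ^ 2 * a + (q ^ 2 - q - 1) := by
  have hns := fun y => IsThin.next_of_switch hq (y := y)
  obtain ⟨hs, hh, hl, hu⟩ := hq
  have hq1 : 1 < q := by linarith
  have hq0 : 0 < q - 1 := by linarith
  have hb0 := pos_of_mul_pow_eq hq1 hb
  have hM := one_div_sub_one_eq hq1 hb
  have hsb0 : 0 < (q ^ 2 - q - 1) * b := mul_pos hs hb0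
  obtain ⟨e1, e2, e3, e4, e5, e6⟩ := mul_pow_chain hq1 hb0
  have hsb : (q ^ 2 - q - 1) * (b * q ^ 5 * (q ^ 2 - 1)) = q ^ 2 - q - 1 := by rw [hb, mul_one]
  have hsb1 : q * ((q ^ 2 - q - 1) * (b * q ^ 5 * (q ^ 2 - 1))) = q * (q ^ 2 - q - 1) := by
    rw [hsb]
  have hsb2 : q ^ 2 * ((q ^ 2 - q - 1) * (b * q ^ 5 * (q ^ 2 - 1))) = q ^ 2 * (q ^ 2 - q - 1) := by
    rw [hsb]
  have hb1 : q * (b * q ^ 5 * (q ^ 2 - 1)) = q := by rw [hb, mul_one]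
  have hb2 : q ^ 2 * (b * q ^ 5 * (q ^ 2 - 1)) = q ^ 2 := by rw [hb, mul_one]
  have f1 : (q ^ 2 - q - 1) * (q ^ 4 + q ^ 3) < 1 := by
    have : 0 < (q ^ 2 - q - 1) * (q ^ 2 + q) := by positivity
    linarith
  have f2 : (q ^ 2 - q - 1) * q ^ 3 < q - 1 := by
    have h1 : 1 < (q - 1) * (q + 1) := by nlinarith
    refine lt_of_mul_lt_mul_right (a := q + 1) ?_ (by linarith)
    linarith
  have p0 := mul_lt_mul_of_pos_left hh (show 0 < b * q ^ 2 * (q - 1) by positivity)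
  have p1 := mul_lt_mul_of_pos_left f1 (show 0 < b * q ^ 2 * (q - 1) by positivity)
  have p2 := mul_lt_mul_of_pos_left f2 (show 0 < b * q ^ 4 by positivity)
  have ha0 := smallUnique_nonneg hq1 ha
  have g2 : q ^ 2 * a ≤ q ^ 2 * (b * q ^ 2) := by gcongr
  have g0 : 0 ≤ q ^ 2 * a := by positivity
  have r7 : (q ^ 2 - q - 1) * b * q ^ 3 < (q ^ 2 - q - 1) * b * q ^ 7 :=
    mul_lt_mul_of_pos_left (pow_lt_pow_right₀ hq1 (by norm_num)) hsb0
  have r4 : (q ^ 2 - q - 1) * q ^ 4 < q ^ 2 - 2 := by nlinarith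
  have p3 := mul_lt_mul_of_pos_left r4 (show 0 < b * q ^ 3 by positivity)
  have f3 : (q ^ 2 - q - 1) * (q ^ 3 + q ^ 2) < 1 := by
    have : 0 < (q ^ 2 - q - 1) * (q ^ 4 + q) := by positivity
    linarith
  have p4 := mul_lt_mul_of_pos_left f3 (show 0 < b * q ^ 3 * (q - 1) by positivity)
  rcases hns _ ht (by linarith) (by linarith) with ⟨hm, ht'⟩ | ⟨hm, ht'⟩
  · refine ⟨_, hm, ht', ?_, by ring⟩
    have c' := smallUnique_cases hq1 hb hm
    generalize ha' : q * (q * (1 + a) - 1) - 1 = a' at c'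
    rcases smallUnique_cases hq1 hb ha with h | h | h | h | ⟨h, h'⟩
    · linarith
    · linarith
    · rw [h] at ha'
      rcases c' with c | c | c | c | c <;> linarith
    · rw [h] at ha'
      rcases c' with c | c | c | c | c <;> linarith
    · have g3 : q ^ 2 * a ≤ q ^ 2 * b := by gcongr
      rcases c' with c | c | c | c | c <;> linarith
  · exfalso
    have c' := smallUnique_cases hq1 hb hm
    generalize ha' : 1 / (q - 1) - q * (q * (1 + a) - 1) = a' at c'
    rw [hM] at ha'
    rcases smallUnique_cases hq1 hb ha with h | h | h | h | ⟨h, h'⟩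
    · linarith
    · linarith
    · rw [h] at ha'
      rcases c' with c | c | c | c | c <;> linarith
    · rw [h] at ha'
      rcases c' with c | c | c | c | c <;> linarith
    · have g3 : q ^ 2 * a ≤ q ^ 2 * b := by gcongr
      rcases c' with c | c | c | c | c <;> linarith

lemma IsThin.next_of_eq_two {q b : ℝ} (hq : IsIntermediate q) (hb : b * q ^ 5 * (q ^ 2 - 1) = 1)
    (ht : IsThin q (q * (1 + b * q ^ 4) - 1)) :
    ∃ a' ∈ smallUnique q, IsThin q (1 + a') ∧ a' ≤ b * q ^ 2 := by
  have hns := fun y => IsThin.next_of_switch hq (y := y)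
  obtain ⟨hs, hh, hl, hu⟩ := hq
  have hq1 : 1 < q := by linarith
  have hq0 : 0 < q - 1 := by linarith
  have hb0 := pos_of_mul_pow_eq hq1 hb
  have hM := one_div_sub_one_eq hq1 hb
  have hsb0 : 0 < (q ^ 2 - q - 1) * b := mul_pos hs hb0
  obtain ⟨e1, e2, e3, e4, e5, e6⟩ := mul_pow_chain hq1 hb0
  have hsb : (q ^ 2 - q - 1) * (b * q ^ 5 * (q ^ 2 - 1)) = q ^ 2 - q - 1 := by rw [hb, mul_one]
  have hsb1 : q * ((q ^ 2 - q - 1) * (b * q ^ 5 * (q ^ 2 - 1))) = q * (q ^ 2 - q - 1) := by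
    rw [hsb]
  have hsb2 : q ^ 2 * ((q ^ 2 - q - 1) * (b * q ^ 5 * (q ^ 2 - 1))) = q ^ 2 * (q ^ 2 - q - 1) := by
    rw [hsb]
  have hb1 : q * (b * q ^ 5 * (q ^ 2 - 1)) = q := by rw [hb, mul_one]
  have hb2 : q ^ 2 * (b * q ^ 5 * (q ^ 2 - 1)) = q ^ 2 := by rw [hb, mul_one]
  have f1 : (q ^ 2 - q - 1) * (q ^ 4 + q ^ 3) < 1 := by
    have : 0 < (q ^ 2 - q - 1) * (q ^ 2 + q) := by positivity
    linarith
  have hsc : 0 < (q ^ 2 - q - 1) * b * q ^ 5 := by positivity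
  have hqs : 0 < q * (q ^ 2 - q - 1) := by positivity
  have ht1 := ht.step_one hq1 (by linarith)
  have ht2 := ht1.step_one hq1 (by linarith)
  have r : (q ^ 2 - q - 1) * (q ^ 2 * (q ^ 4 - q ^ 2 - 1)) < 1 := by nlinarith
  have p5 := mul_lt_mul_of_pos_left r (show 0 < b * q ^ 3 by positivity)
  have p6 := mul_lt_mul_of_pos_left f1 (show 0 < b * q ^ 4 * (q - 1) by positivity)
  have hc : 0 < (q ^ 2 - q - 1) * (q ^ 2 - b * q ^ 5) := by
    refine mul_pos hs ?_
    nlinarith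
  rcases hns _ ht2 (by linarith) (by linarith) with ⟨hm, ht'⟩ | ⟨hm, ht'⟩
  · refine ⟨_, hm, ht', ?_⟩
    rcases smallUnique_cases hq1 hb hm with c | c | c | c | c <;> linarith
  · exfalso
    rcases smallUnique_cases hq1 hb hm with c | c | c | c | c <;> linarith

lemma IsThin.next_of_eq_three {q b : ℝ} (hq : IsIntermediate q)
    (hb : b * q ^ 5 * (q ^ 2 - 1) = 1) (ht : IsThin q (q * (1 + b * q ^ 3) - 1)) :
    ∃ a' ∈ smallUnique q, IsThin q (1 + a') ∧ a' ≤ b * q ^ 2 := by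
  have hns := fun y => IsThin.next_of_switch hq (y := y)
  obtain ⟨hs, hh, hl, hu⟩ := hq
  have hq1 : 1 < q := by linarith
  have hq0 : 0 < q - 1 := by linarith
  have hb0 := pos_of_mul_pow_eq hq1 hb
  have hM := one_div_sub_one_eq hq1 hb
  have hsb0 : 0 < (q ^ 2 - q - 1) * b := mul_pos hs hb0
  obtain ⟨e1, e2, e3, e4, e5, e6⟩ := mul_pow_chain hq1 hb0
  have hsb : (q ^ 2 - q - 1) * (b * q ^ 5 * (q ^ 2 - 1)) = q ^ 2 - q - 1 := by rw [hb, mul_one]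
  have hsb1 : q * ((q ^ 2 - q - 1) * (b * q ^ 5 * (q ^ 2 - 1))) = q * (q ^ 2 - q - 1) := by
    rw [hsb]
  have hsb2 : q ^ 2 * ((q ^ 2 - q - 1) * (b * q ^ 5 * (q ^ 2 - 1))) = q ^ 2 * (q ^ 2 - q - 1) := by
    rw [hsb]
  have hb1 : q * (b * q ^ 5 * (q ^ 2 - 1)) = q := by rw [hb, mul_one]
  have hb2 : q ^ 2 * (b * q ^ 5 * (q ^ 2 - 1)) = q ^ 2 := by rw [hb, mul_one]
  have f1 : (q ^ 2 - q - 1) * (q ^ 4 + q ^ 3) < 1 := by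
    have : 0 < (q ^ 2 - q - 1) * (q ^ 2 + q) := by positivity
    linarith
  have hsc : 0 < (q ^ 2 - q - 1) * b * q ^ 5 := by positivity
  have hqs : 0 < q * (q ^ 2 - q - 1) := by positivity
  have ht1 := ht.step_one hq1 (by linarith)
  have r : (q ^ 2 - q - 1) * (q ^ 2 * (q ^ 3 - q - 1)) < 1 := by nlinarith
  have p5 := mul_lt_mul_of_pos_left r (show 0 < b * q ^ 3 by positivity)
  have p6 := mul_lt_mul_of_pos_left f1 (show 0 < b * q ^ 3 * (q - 1) by positivity)
  have p7 : 0 < b * q ^ 3 * (q - 1) * (q - 1) := by positivity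
  have hc : 0 < (q ^ 2 - q - 1) * (q - b * q ^ 5) := by
    refine mul_pos hs ?_
    nlinarith
  rcases hns _ ht1 (by linarith) (by linarith) with ⟨hm, ht'⟩ | ⟨hm, ht'⟩
  · refine ⟨_, hm, ht', ?_⟩
    rcases smallUnique_cases hq1 hb hm with c | c | c | c | c <;> linarith
  · exfalso
    rcases smallUnique_cases hq1 hb hm with c | c | c | c | c <;> linarith

lemma IsThin.tmap_one_of_mem_smallUnique {q a : ℝ} (hq : IsIntermediate q) (ha : a ∈ smallUnique q)
    (h : IsThin q (1 + a)) : IsThin q (q * (1 + a) - 1) := by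
  obtain ⟨hs, -, hl, -⟩ := hq
  have ha0 := smallUnique_nonneg (by linarith) ha
  refine h.step_one (by linarith) ?_
  rw [div_lt_iff₀ (by linarith)]
  nlinarith

lemma IsThin.exists_next {q b a : ℝ} (hq : IsIntermediate q) (hb : b * q ^ 5 * (q ^ 2 - 1) = 1)
    (ha : a ∈ smallUnique q) (h : IsThin q (1 + a)) :
    ∃ a' ∈ smallUnique q, IsThin q (1 + a') ∧ a' ≤ b * q ^ 2 := by
  have hq1 : 1 < q := by linarith [hq.lower]
  have hb0 := pos_of_mul_pow_eq hq1 hb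
  obtain ⟨e1, e2, -⟩ := mul_pow_chain hq1 hb0
  have ht := h.tmap_one_of_mem_smallUnique hq ha
  have hle : a ≤ b * q ^ 2 → ∃ a' ∈ smallUnique q, IsThin q (1 + a') ∧ a' ≤ b * q ^ 2 := fun hab => by
    obtain ⟨a', m, t, l, -⟩ := IsThin.next_of_le hq hb ha hab ht
    exact ⟨a', m, t, l⟩
  rcases smallUnique_cases hq1 hb ha with rfl | rfl | h2 | h1 | h0
  · exact IsThin.next_of_eq_two hq hb ht
  · exact IsThin.next_of_eq_three hq hb ht
  · exact hle (by linarith)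
  · exact hle (by linarith)
  · exact hle (by linarith)

lemma not_isThin {q : ℝ} (hq : IsIntermediate q) (x : ℝ) : ¬ IsThin q x := by
  intro hx
  have hns := fun y => IsThin.next_of_switch hq (y := y)
  have hq1 : 1 < q := by linarith [hq.lower]
  have hpos : 0 < q ^ 2 - 1 := by nlinarith
  obtain ⟨y, hy, h0, h1⟩ := hx.exists_switch hq1
  rw [Tmap_zero] at h0
  rw [Tmap_one] at h1
  obtain ⟨a, ha, hta⟩ : ∃ a ∈ smallUnique q, IsThin q (1 + a) := by
    rcases hns y hy (by linarith [h1.1]) h0.2 with h | h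
    · exact ⟨_, h⟩
    · exact ⟨_, h⟩
  obtain ⟨b, hb⟩ : ∃ b, b * q ^ 5 * (q ^ 2 - 1) = 1 := ⟨1 / (q ^ 5 * (q ^ 2 - 1)), by field_simp⟩
  obtain ⟨a₁, m₁, t₁, l₁⟩ := IsThin.exists_next hq hb ha hta
  obtain ⟨a₂, m₂, t₂, l₂, e₂⟩ :=
    IsThin.next_of_le hq hb m₁ l₁ (t₁.tmap_one_of_mem_smallUnique hq m₁)
  obtain ⟨a₃, m₃, -, -, e₃⟩ :=
    IsThin.next_of_le hq hb m₂ l₂ (t₂.tmap_one_of_mem_smallUnique hq m₂)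
  have hs := hq.golden_lt
  have h1 := smallUnique_nonneg hq1 m₁
  have h2 : 0 < a₂ := by rw [e₂]; positivity
  have h3 := smallUnique_gap hq1 m₂ m₃ h2 (by linarith)
  have h4 : 0 ≤ q ^ 2 * a₁ := by positivity
  have h5 : 0 < q ^ 3 - q ^ 2 - 1 := by nlinarith
  nlinarith [mul_pos h5 h2]

lemma isIntermediate_of_lt {q r : ℝ} (hq : 1 < q) (hG : 0 < q ^ 2 - q - 1) (hqr : q < r)
    (hr : r ^ 6 = r ^ 4 + r ^ 3 + 2 * r ^ 2 + r + 1) : IsIntermediate q := by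
  have hprod : (q ^ 2 - q - 1) * (q ^ 4 + q ^ 3 + q ^ 2 + q) < 1 := by
    calc (q ^ 2 - q - 1) * (q ^ 4 + q ^ 3 + q ^ 2 + q)
        < (r ^ 2 - r - 1) * (r ^ 4 + r ^ 3 + r ^ 2 + r) := by
          refine mul_lt_mul'' ?_ (by gcongr) hG.le (by positivity)
          nlinarith
      _ = 1 := by linear_combination hr
  refine ⟨hG, hprod, by nlinarith, ?_⟩
  by_contra! hc
  have h1 : (0.07 : ℝ) ≤ q ^ 2 - q - 1 := by nlinarith
  have h2 : (15 : ℝ) ≤ q ^ 4 + q ^ 3 + q ^ 2 + q := by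
    calc (15 : ℝ) ≤ 1.65 ^ 4 + 1.65 ^ 3 + 1.65 ^ 2 + 1.65 := by norm_num
      _ ≤ _ := by gcongr
  nlinarith

lemma eq_flip_of_Tmap_notMem {q : ℝ} (hq : 1 < q) {x : ℝ} {d : Fin 2} (h : Tmap q d x ∉ Iq q)
    {ε : ℕ → Fin 2} (hε : ε ∈ SigmaSet q x) : ε 0 = 1 - d := by
  refine (digit_eq_or_eq_flip d (ε 0)).resolve_left fun h0 => h ?_
  rw [← h0]
  exact mem_Iq_of_mem_SigmaSet hq (tail_mem_SigmaSet hq hε)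

/-- If one of the two maps leaves the interval, uniqueness of the expansion pulls back along the
other one. -/
lemma subsingleton_of_Tmap_notMem {q : ℝ} (hq : 1 < q) {x : ℝ} {d : Fin 2}
    (h : Tmap q d x ∉ Iq q) (hs : (SigmaSet q (Tmap q (1 - d) x)).Subsingleton) :
    (SigmaSet q x).Subsingleton := by
  intro ε hε δ hδ
  have e0 := eq_flip_of_Tmap_notMem hq h hε
  have d0 := eq_flip_of_Tmap_notMem hq h hδ
  have e1 := tail_mem_SigmaSet hq hε
  have d1 := tail_mem_SigmaSet hq hδ
  rw [e0] at e1
  rw [d0] at d1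
  rw [← consSeq_head_tail ε, ← consSeq_head_tail δ, e0, d0, hs e1 d1]

lemma notMem_Iq_of_neg {q x : ℝ} (h : x < 0) : x ∉ Iq q := fun hx => not_lt.2 hx.1 h

lemma notMem_Iq_of_lt {q x : ℝ} (h : 1 / (q - 1) < x) : x ∉ Iq q := fun hx => not_lt.2 hx.2 h

/-- The point `(01)^∞` has a unique expansion above the golden ratio. -/
lemma subsingleton_two_cycle {q c : ℝ} (hq : 1 < q) (hG : q + 1 < q ^ 2)
    (hc : c * (q ^ 2 - 1) = 1) : (SigmaSet q c).Subsingleton := by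
  have hs : 0 < q ^ 2 - 1 := by nlinarith
  have n1 : Tmap q 1 c ∉ Iq q := by
    refine notMem_Iq_of_neg ?_
    rw [Tmap_one]
    nlinarith
  have n0 : Tmap q 0 (q * c) ∉ Iq q := by
    refine notMem_Iq_of_lt ?_
    rw [Tmap_zero, div_lt_iff₀ (by linarith)]
    nlinarith
  have key : ∀ n, (∀ ε ∈ SigmaSet q c, ∀ δ ∈ SigmaSet q c, ε n = δ n) ∧
      ∀ ε ∈ SigmaSet q (q * c), ∀ δ ∈ SigmaSet q (q * c), ε n = δ n := by
    intro n
    induction n with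
    | zero =>
      exact ⟨fun ε hε δ hδ => (eq_flip_of_Tmap_notMem hq n1 hε).trans
          (eq_flip_of_Tmap_notMem hq n1 hδ).symm,
        fun ε hε δ hδ => (eq_flip_of_Tmap_notMem hq n0 hε).trans
          (eq_flip_of_Tmap_notMem hq n0 hδ).symm⟩
    | succ n ih =>
      have t1 : ∀ ε ∈ SigmaSet q c, (fun n => ε (n + 1)) ∈ SigmaSet q (q * c) := fun ε hε => by
        have := tail_mem_SigmaSet hq hε
        rwa [eq_flip_of_Tmap_notMem hq n1 hε, sub_self, Tmap_zero] at this
      have t0 : ∀ ε ∈ SigmaSet q (q * c), (fun n => ε (n + 1)) ∈ SigmaSet q c := fun ε hε => by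
        have := tail_mem_SigmaSet hq hε
        rw [eq_flip_of_Tmap_notMem hq n0 hε, sub_zero, Tmap_one] at this
        rwa [show q * (q * c) - 1 = c by linear_combination hc] at this
      exact ⟨fun ε hε δ hδ => ih.2 _ (t1 ε hε) _ (t1 δ hδ),
        fun ε hε δ hδ => ih.1 _ (t0 ε hε) _ (t0 δ hδ)⟩
  exact fun ε hε δ hδ => funext fun n => (key n).1 ε hε δ hδ

/-- Prefix `11` to the reflection of a sequence. -/
def reflectStep (σ : ℕ → Fin 2) : ℕ → Fin 2 := consSeq 1 (consSeq 1 (flipSeq σ))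

lemma reflectStep_injective : Function.Injective reflectStep :=
  (consSeq_injective 1).comp ((consSeq_injective 1).comp flipSeq_involutive.injective)

lemma infinite_of_eq_insert {S : Set (ℕ → Fin 2)} {e : ℕ → Fin 2}
    (hS : S = insert e (reflectStep '' S)) (he : e ∉ range reflectStep) : S.Infinite := by
  intro hfin
  have h1 : S.ncard = S.ncard + 1 := by
    conv_lhs => rw [hS]
    rw [ncard_insert_of_notMem (fun h => he (image_subset_range _ _ h)) (hfin.image _),
      ncard_image_of_injective _ reflectStep_injective]
  omega

lemma countable_of_eq_insert {S : Set (ℕ → Fin 2)} {e : ℕ → Fin 2}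
    (hS : S = insert e (reflectStep '' S)) : S.Countable := by
  let A : Set (ℕ → Fin 2) := range fun n => reflectStep^[n] e
  have hstep : ∀ σ ∈ S \ A, ∃ τ ∈ S \ A, reflectStep τ = σ := by
    rintro σ ⟨hσ, hσA⟩
    rw [hS] at hσ
    rcases hσ with rfl | ⟨τ, hτ, rfl⟩
    · exact absurd ⟨0, rfl⟩ hσA
    · refine ⟨τ, ⟨hτ, ?_⟩, rfl⟩
      rintro ⟨n, rfl⟩
      exact hσA ⟨n + 1, Function.iterate_succ_apply' _ _ _⟩
  have hsub : (S \ A).Subsingleton := by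
    have key : ∀ k, ∀ σ ∈ S \ A, ∀ τ ∈ S \ A, σ k = τ k := by
      intro k
      induction k using Nat.strong_induction_on with
      | _ k ih =>
        intro σ hσ τ hτ
        obtain ⟨σ', hσ', rfl⟩ := hstep σ hσ
        obtain ⟨τ', hτ', rfl⟩ := hstep τ hτ
        match k with
        | 0 => rfl
        | 1 => rfl
        | k + 2 => exact congrArg (1 - ·) (ih k (by omega) σ' hσ' τ' hτ')
    exact fun σ hσ τ hτ => funext fun k => key k σ hσ τ hτ
  refine ((countable_range fun n => reflectStep^[n] e).union hsub.countable).mono fun σ hσ => ?_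
  by_cases h : σ ∈ A
  · exact Or.inl h
  · exact Or.inr ⟨hσ, h⟩

lemma mem_BAleph0_of_root {q : ℝ} (hq1 : 1 < q) (hq2 : q < 2) (hG : 0 < q ^ 2 - q - 1)
    (hroot : q ^ 6 = q ^ 4 + q ^ 3 + 2 * q ^ 2 + q + 1) : q ∈ BAleph0 := by
  have hs : 0 < q ^ 2 - 1 := by nlinarith
  have hq0 : 0 < q - 1 := by linarith
  obtain ⟨a, ha⟩ : ∃ a, a * q ^ 3 * (q ^ 2 - 1) = 1 := ⟨1 / (q ^ 3 * (q ^ 2 - 1)), by field_simp⟩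
  have ha0 : 0 < a := by
    by_contra! hc
    have : a * q ^ 3 * (q ^ 2 - 1) ≤ 0 :=
      mul_nonpos_of_nonpos_of_nonneg (mul_nonpos_of_nonpos_of_nonneg hc (by positivity)) hs.le
    linarith
  have hM : 1 / (q - 1) = q ^ 2 - q + (q ^ 2 + 1) * a := by
    rw [div_eq_iff hq0.ne']
    refine mul_right_cancel₀ (mul_pos (pow_pos (by linarith : 0 < q) 3) hs).ne' ?_
    linear_combination -(q - 1) ^ 2 * hroot - (q ^ 2 + 1) * (q - 1) * ha
  have e1 : a < q * a := by nlinarith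
  have e2 : q * a < q * (q * a) := by nlinarith
  have e3 : q * (q * a) < q * (q * (q * a)) := by nlinarith
  have hc1 : q * (q * (q * a)) < 1 := by nlinarith
  have ha1 : a < 1 := by linarith
  have hsub : (SigmaSet q a).Subsingleton := by
    have h3 := subsingleton_two_cycle hq1 (by linarith) ha
    have hneg : ∀ y, q * y < 1 → Tmap q 1 y ∉ Iq q := fun y hy => by
      refine notMem_Iq_of_neg ?_
      rw [Tmap_one]
      linarith
    refine subsingleton_of_Tmap_notMem hq1 (hneg _ (by linarith)) ?_
    rw [sub_self, Tmap_zero]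
    refine subsingleton_of_Tmap_notMem hq1 (hneg _ (by linarith)) ?_
    rw [sub_self, Tmap_zero]
    refine subsingleton_of_Tmap_notMem hq1 (hneg _ (by linarith)) ?_
    rw [sub_self, Tmap_zero]
    convert h3 using 2
    ring
  have hx : 1 + a < 1 / (q - 1) := by
    rw [hM]
    nlinarith
  obtain ⟨α, hα⟩ := SigmaSet_nonempty hq1 hq2 (x := a) ⟨ha0.le, by linarith⟩
  have hSa : SigmaSet q a = {α} := hsub.eq_singleton_of_mem hα
  have hempty : SigmaSet q (Tmap q 0 (1 + a)) = ∅ := by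
    refine SigmaSet_eq_empty hq1 (notMem_Iq_of_lt ?_)
    rw [Tmap_zero, div_lt_iff₀ hq0]
    nlinarith
  have hy0 : Tmap q 0 (Tmap q 1 (1 + a)) = 1 / (q - 1) - a := by
    rw [Tmap_zero, Tmap_one, hM]
    ring
  have hy1 : Tmap q 1 (Tmap q 1 (1 + a)) = 1 / (q - 1) - (1 + a) := by
    rw [Tmap_one q (Tmap q 1 (1 + a)), Tmap_one, hM]
    ring
  have hS : SigmaSet q (1 + a) =
      insert (consSeq 1 (consSeq 0 (flipSeq α))) (reflectStep '' SigmaSet q (1 + a)) := by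
    conv_lhs => rw [SigmaSet_eq_union hq1, hempty, SigmaSet_eq_union hq1 (Tmap q 1 (1 + a)), hy0,
      hy1, SigmaSet_reflect hq1, SigmaSet_reflect hq1, hSa]
    simp only [image_empty, empty_union, image_singleton, image_image, singleton_union,
      image_insert_eq]
    rfl
  have he : consSeq 1 (consSeq 0 (flipSeq α)) ∉ range reflectStep := by
    rintro ⟨σ, h⟩
    simpa [reflectStep, consSeq] using congrFun h 1
  have := (infinite_of_eq_insert hS he).to_subtype
  have := (countable_of_eq_insert hS).to_subtype
  exact ⟨⟨hq1, hq2⟩, 1 + a, ⟨by linarith, hx⟩, Cardinal.mk_eq_aleph0 _⟩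

lemma notMem_BAleph0 {q : ℝ} (hq : IsIntermediate q) : q ∉ BAleph0 := by
  rintro ⟨⟨hq1, -⟩, x, -, hx⟩
  have hinf : (SigmaSet q x).Infinite :=
    infinite_coe_iff.1 (Cardinal.infinite_iff.2 hx.ge)
  obtain ⟨y, hy⟩ := exists_isThin hq1 hinf (Cardinal.le_aleph0_iff_set_countable.1 hx.le)
  exact not_isThin hq y hy

lemma golden_lt_iff {q : ℝ} (hq : 1 < q) : (1 + Real.sqrt 5) / 2 < q ↔ 0 < q ^ 2 - q - 1 := by
  have h5 := Real.sq_sqrt (show (0 : ℝ) ≤ 5 by norm_num)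
  have h0 := Real.sqrt_nonneg 5
  constructor <;> intro h
  · nlinarith
  · by_contra! hc
    nlinarith

/-- The smallest element of `B_{ℵ₀}` strictly greater than the golden ratio
`(1+√5)/2` is `q_{ℵ₀}`, the unique root in `(1,2)` of `x⁶ = x⁴ + x³ + 2x² + x + 1`. -/
theorem smallest_element_of_BAleph0_above_golden
    (qA : ℝ) (hqA1 : qA ∈ Set.Ioo (1 : ℝ) 2)
    (hqA2 : qA ^ 6 = qA ^ 4 + qA ^ 3 + 2 * qA ^ 2 + qA + 1) :
    IsLeast {q ∈ BAleph0 | (1 + Real.sqrt 5) / 2 < q} qA := by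
  obtain ⟨h1, h2⟩ := hqA1
  have hG : 0 < qA ^ 2 - qA - 1 := by
    refine pos_of_mul_pos_left (b := qA ^ 4 + qA ^ 3 + qA ^ 2 + qA) ?_ (by positivity)
    linarith
  refine ⟨⟨mem_BAleph0_of_root h1 h2 hG hqA2, (golden_lt_iff h1).2 hG⟩, ?_⟩
  rintro q ⟨hB, hq⟩
  by_contra! hlt
  exact notMem_BAleph0 (isIntermediate_of_lt hB.1.1 ((golden_lt_iff hB.1.1).1 hq) hlt hqA2) hB
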